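/- Boundedness of the discrete-in-time iterates for the 1-2 junction scheme: if f^{1,n}, f^{2,n}, f^{3,n} ∈ B and the time step satisfies Δt < 1/(1 + 2η_0), then the explicit Euler updates of the 1-2 junction scheme satisfy f^{r,n+1}_j ≤ 1 for all j = 1,...,n and r = 1,2,3. -/

import Mathlib

open Set

noncomputable def rhoF {n : ℕ} (f : Fin n → ℝ) : ℝ := ∑ j, f j

noncomputable def fluxF {n : ℕ} (v f : Fin n → ℝ) : ℝ := ∑ j, v j * f j

noncomputable def gainF {n : ℕ} (η0 : ℝ) (A : Fin n → Fin n → Fin n → ℝ → ℝ)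
    (j : Fin n) (f : Fin n → ℝ) : ℝ :=
  η0 * rhoF f * ∑ h, ∑ k, A h k j (rhoF f) * f h * f k

noncomputable def lossF {n : ℕ} (η0 : ℝ) (f : Fin n → ℝ) : ℝ := η0 * (rhoF f) ^ 2

def admissibleF {n : ℕ} (f : Fin n → ℝ) : Prop :=
  (∀ j, 0 ≤ f j ∧ f j ≤ 1) ∧ rhoF f ≤ 1

noncomputable def deltaC {n : ℕ} (j : Fin n) : ℝ := if (j : ℕ) = 0 then 0 else 1

def IsSpeedLattice {n : ℕ} (hn : 2 ≤ n) (v : Fin n → ℝ) : Prop :=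
  StrictMono v ∧ v ⟨0, by omega⟩ = 0 ∧ v ⟨n - 1, by omega⟩ = 1

def IsFluxLimiterW (Φ : ℝ → ℝ → ℝ) : Prop :=
  (∀ u ∈ Icc (0:ℝ) 1, ∀ w ∈ Icc (0:ℝ) 1, Φ u w ∈ Icc (0:ℝ) 1) ∧
  (∀ u ∈ Icc (0:ℝ) 1, ∀ w ∈ Icc (0:ℝ) 1, 1 < u + w → Φ u w * u ≤ 1 - w)

def IsTableOfGamesW {n : ℕ} (A : Fin n → Fin n → Fin n → ℝ → ℝ) : Prop :=
  (∀ h k j : Fin n, ∀ u ∈ Icc (0:ℝ) 1, A h k j u ∈ Icc (0:ℝ) 1) ∧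
  (∀ h k : Fin n, ∀ u ∈ Icc (0:ℝ) 1, ∑ j, A h k j u = 1)

noncomputable def euler1 {n : ℕ} (v : Fin n → ℝ) (η0 : ℝ) (A : Fin n → Fin n → Fin n → ℝ → ℝ)
    (Φ : ℝ → ℝ → ℝ) (a Δt : ℝ) (fbar1 f1 f2 f3 : Fin n → ℝ) (j : Fin n) : ℝ :=
  f1 j - Δt * v j * ((a * Φ (a * ∑ k, deltaC k * f1 k) (rhoF f2)
      + (1 - a) * Φ ((1 - a) * ∑ k, deltaC k * f1 k) (rhoF f3)) * f1 j
    - Φ (∑ k, fbar1 k) (rhoF f1) * fbar1 j)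
  + Δt * (gainF η0 A j f1 - f1 j * lossF η0 f1)

noncomputable def euler2 {n : ℕ} (v : Fin n → ℝ) (η0 : ℝ) (A : Fin n → Fin n → Fin n → ℝ → ℝ)
    (Φ : ℝ → ℝ → ℝ) (a Δt : ℝ) (Φbar2 : ℝ) (f1 f2 : Fin n → ℝ) (j : Fin n) : ℝ :=
  f2 j - Δt * v j * (Φbar2 * f2 j
    - a * Φ (a * ∑ k, deltaC k * f1 k) (rhoF f2) * f1 j * deltaC j)
  + Δt * (gainF η0 A j f2 - f2 j * lossF η0 f2)

noncomputable def euler3 {n : ℕ} (v : Fin n → ℝ) (η0 : ℝ) (A : Fin n → Fin n → Fin n → ℝ → ℝ)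
    (Φ : ℝ → ℝ → ℝ) (a Δt : ℝ) (Φbar3 : ℝ) (f1 f3 : Fin n → ℝ) (j : Fin n) : ℝ :=
  f3 j - Δt * v j * (Φbar3 * f3 j
    - (1 - a) * Φ ((1 - a) * ∑ k, deltaC k * f1 k) (rhoF f3) * f1 j * deltaC j)
  + Δt * (gainF η0 A j f3 - f3 j * lossF η0 f3)

theorem speed_mem_Icc {n : ℕ} {hn : 2 ≤ n} {v : Fin n → ℝ} (hv : IsSpeedLattice hn v)
    (j : Fin n) : v j ∈ Icc (0:ℝ) 1 := by
  obtain ⟨hmono, h0, h1⟩ := hv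
  constructor
  · rw [← h0]
    exact hmono.monotone (Fin.le_def.2 (Nat.zero_le _))
  · rw [← h1]
    exact hmono.monotone (Fin.le_def.2 (Nat.le_sub_one_of_lt j.2))

theorem admissibleF.rhoF_nonneg {n : ℕ} {f : Fin n → ℝ} (hf : admissibleF f) : 0 ≤ rhoF f :=
  Finset.sum_nonneg fun j _ => (hf.1 j).1

theorem admissibleF.rhoF_mem_Icc {n : ℕ} {f : Fin n → ℝ} (hf : admissibleF f) :
    rhoF f ∈ Icc (0:ℝ) 1 :=
  ⟨hf.rhoF_nonneg, hf.2⟩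

theorem admissibleF.le_rhoF {n : ℕ} {f : Fin n → ℝ} (hf : admissibleF f) (j : Fin n) :
    f j ≤ rhoF f :=
  Finset.single_le_sum (fun i _ => (hf.1 i).1) (Finset.mem_univ j)

theorem deltaC_mem_Icc {n : ℕ} (j : Fin n) : (deltaC j : ℝ) ∈ Icc (0:ℝ) 1 := by
  unfold deltaC
  split_ifs <;> simp

theorem admissibleF.deltaC_mul {n : ℕ} {f : Fin n → ℝ} (hf : admissibleF f) :
    admissibleF fun k => deltaC k * f k := by
  have hle (k : Fin n) : deltaC k * f k ≤ f k :=
    mul_le_of_le_one_left (hf.1 k).1 (deltaC_mem_Icc k).2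
  exact ⟨fun k => ⟨mul_nonneg (deltaC_mem_Icc k).1 (hf.1 k).1, (hle k).trans (hf.1 k).2⟩,
    (Finset.sum_le_sum fun k _ => hle k).trans hf.2⟩

theorem admissibleF.const_mul_mem_Icc {n : ℕ} {f : Fin n → ℝ} (hf : admissibleF f) {c : ℝ}
    (hc : c ∈ Icc (0:ℝ) 1) : c * rhoF f ∈ Icc (0:ℝ) 1 :=
  ⟨mul_nonneg hc.1 hf.rhoF_nonneg, mul_le_one₀ hc.2 hf.rhoF_nonneg hf.2⟩

/-- The limited flux never exceeds the free space. -/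
theorem IsFluxLimiterW.mul_le {Φ : ℝ → ℝ → ℝ} (hΦ : IsFluxLimiterW Φ) {u w : ℝ}
    (hu : u ∈ Icc (0:ℝ) 1) (hw : w ∈ Icc (0:ℝ) 1) : Φ u w * u ≤ 1 - w := by
  rcases lt_or_ge 1 (u + w) with h | h
  · exact hΦ.2 u hu w hw h
  · have := mul_le_of_le_one_left hu.1 (hΦ.1 u hu w hw).2
    linarith

theorem gainF_le {n : ℕ} {η0 : ℝ} (hη0 : 0 ≤ η0) {A : Fin n → Fin n → Fin n → ℝ → ℝ}
    (hA : IsTableOfGamesW A) {f : Fin n → ℝ} (hf : admissibleF f) (j : Fin n) :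
    gainF η0 A j f ≤ η0 * rhoF f ^ 3 := by
  have hsum : ∑ h, ∑ k, A h k j (rhoF f) * f h * f k ≤ rhoF f * rhoF f := by
    conv_rhs => rw [rhoF, Finset.sum_mul_sum]
    refine Finset.sum_le_sum fun h _ => Finset.sum_le_sum fun k _ => ?_
    exact mul_le_mul_of_nonneg_right
      (mul_le_of_le_one_left (hf.1 h).1 (hA.1 h k j _ hf.rhoF_mem_Icc).2) (hf.1 k).1
  calc gainF η0 A j f ≤ η0 * rhoF f * (rhoF f * rhoF f) :=
        mul_le_mul_of_nonneg_left hsum (mul_nonneg hη0 hf.rhoF_nonneg)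
    _ = η0 * rhoF f ^ 3 := by ring

/-- One explicit Euler step with nonnegative outflow and inflow bounded by the free space
keeps each component at most `1`. -/
theorem euler_step_le_one {n : ℕ} {η0 : ℝ} (hη0 : 0 ≤ η0)
    {A : Fin n → Fin n → Fin n → ℝ → ℝ} (hA : IsTableOfGamesW A)
    {f : Fin n → ℝ} (hf : admissibleF f) {Δt w outflow inflow : ℝ} (hΔt0 : 0 ≤ Δt)
    (hΔt : Δt * (1 + η0) ≤ 1) (hw : w ∈ Icc (0:ℝ) 1) (hout : 0 ≤ outflow)
    (hin : inflow ≤ 1 - rhoF f) (j : Fin n) :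
    f j - Δt * w * (outflow - inflow) + Δt * (gainF η0 A j f - f j * lossF η0 f) ≤ 1 := by
  have hρ := hf.rhoF_mem_Icc
  have hj := hf.le_rhoF j
  have htransport : -(w * (outflow - inflow)) ≤ 1 - f j := by
    have h₁ := mul_nonneg hw.1 hout
    have h₂ := mul_le_mul_of_nonneg_left hin hw.1
    have h₃ := mul_le_of_le_one_left (sub_nonneg.2 hρ.2) hw.2
    linarith
  have hinteraction : gainF η0 A j f - f j * lossF η0 f ≤ η0 * (1 - f j) := by
    have hsq : rhoF f ^ 2 ≤ 1 := pow_le_one₀ hρ.1 hρ.2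
    have h₁ : rhoF f ^ 2 * (rhoF f - f j) ≤ 1 - f j :=
      (mul_le_of_le_one_left (sub_nonneg.2 hj) hsq).trans (by linarith [hρ.2])
    have h₂ := mul_le_mul_of_nonneg_left h₁ hη0
    have h₃ := gainF_le hη0 hA hf j
    unfold lossF
    linarith
  have hstep := mul_le_mul_of_nonneg_left (add_le_add htransport hinteraction) hΔt0
  have hsmall := mul_le_mul_of_nonneg_right hΔt (sub_nonneg.2 (hf.1 j).2)
  linarith

/-- The flux through the junction into an outgoing road, in each speed class, is at most the
free space of that road. -/
theorem junction_inflow_le {n : ℕ} {Φ : ℝ → ℝ → ℝ} (hΦ : IsFluxLimiterW Φ) {c : ℝ}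
    (hc : c ∈ Icc (0:ℝ) 1) {f g : Fin n → ℝ} (hf : admissibleF f) (hg : admissibleF g)
    (j : Fin n) :
    c * Φ (c * ∑ k, deltaC k * f k) (rhoF g) * f j * deltaC j ≤ 1 - rhoF g := by
  have hu := hf.deltaC_mul.const_mul_mem_Icc hc
  have hΦ0 := (hΦ.1 _ hu _ hg.rhoF_mem_Icc).1
  have hle := mul_le_mul_of_nonneg_left
    (mul_le_mul_of_nonneg_left (hf.deltaC_mul.le_rhoF j) hc.1) hΦ0
  have hlim := hΦ.mul_le hu hg.rhoF_mem_Icc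
  simp only [rhoF] at hle hlim ⊢
  linarith

/-- Boundedness of the discrete-in-time iterates for the 1-2 junction scheme. -/
theorem euler_scheme_le_one
    {n : ℕ} (hn : 2 ≤ n) (v : Fin n → ℝ) (hv : IsSpeedLattice hn v)
    (η0 : ℝ) (hη0 : 0 < η0)
    (A : Fin n → Fin n → Fin n → ℝ → ℝ) (hA : IsTableOfGamesW A)
    (Φ : ℝ → ℝ → ℝ) (hΦ : IsFluxLimiterW Φ)
    (a : ℝ) (ha : a ∈ Icc (0:ℝ) 1)
    (f1 f2 f3 fbar1 : Fin n → ℝ)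
    (hf1 : admissibleF f1) (hf2 : admissibleF f2) (hf3 : admissibleF f3)
    (hfbar1 : admissibleF fbar1)
    (Φbar2 Φbar3 : ℝ) (hΦbar2 : Φbar2 ∈ Icc (0:ℝ) 1) (hΦbar3 : Φbar3 ∈ Icc (0:ℝ) 1)
    (Δt : ℝ) (hΔt0 : 0 < Δt)
    (hΔt : Δt < 1 / (1 + 2 * η0)) :
    ∀ j : Fin n,
      euler1 v η0 A Φ a Δt fbar1 f1 f2 f3 j ≤ 1 ∧
      euler2 v η0 A Φ a Δt Φbar2 f1 f2 j ≤ 1 ∧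
      euler3 v η0 A Φ a Δt Φbar3 f1 f3 j ≤ 1 := by
  intro j
  have hw := speed_mem_Icc hv j
  have ha' : 1 - a ∈ Icc (0:ℝ) 1 := ⟨by linarith [ha.2], by linarith [ha.1]⟩
  have hΔt' : Δt * (1 + η0) ≤ 1 := by
    rw [lt_div_iff₀ (by positivity)] at hΔt
    linarith [mul_pos hΔt0 hη0]
  refine ⟨?_, ?_, ?_⟩
  · refine euler_step_le_one hη0.le hA hf1 hΔt0.le hΔt' hw ?_ ?_ j
    · have h₂ := (hΦ.1 _ (hf1.deltaC_mul.const_mul_mem_Icc ha) _ hf2.rhoF_mem_Icc).1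
      have h₃ := (hΦ.1 _ (hf1.deltaC_mul.const_mul_mem_Icc ha') _ hf3.rhoF_mem_Icc).1
      exact mul_nonneg (add_nonneg (mul_nonneg ha.1 h₂) (mul_nonneg ha'.1 h₃)) (hf1.1 j).1
    · exact (mul_le_mul_of_nonneg_left (hfbar1.le_rhoF j)
        (hΦ.1 _ hfbar1.rhoF_mem_Icc _ hf1.rhoF_mem_Icc).1).trans
        (hΦ.mul_le hfbar1.rhoF_mem_Icc hf1.rhoF_mem_Icc)
  · exact euler_step_le_one hη0.le hA hf2 hΔt0.le hΔt' hw
      (mul_nonneg hΦbar2.1 (hf2.1 j).1) (junction_inflow_le hΦ ha hf1 hf2 j) j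
  · exact euler_step_le_one hη0.le hA hf3 hΔt0.le hΔt' hw
      (mul_nonneg hΦbar3.1 (hf3.1 j).1) (junction_inflow_le hΦ ha' hf1 hf3 j) j
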